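/- arXiv:1812.04876 — 2 statements merged into one kernel-verified Lean document; each statement's English description precedes it below -/
import Mathlib

section
/- For every real δ > 1, with a(δ) = δ²/(δ²+δ−1), one has √(a(δ)+1)/(δ·(a(δ)+1+√(a(δ)+1))) > (√2−1)/δ, i.e. κ(δ) > (√2−1)/δ; moreover at δ = 1 one has κ(1) = √2−1. -/
/-- a(δ) = δ²/(δ²+δ−1). -/
noncomputable def aFn (δ : ℝ) : ℝ := δ ^ 2 / (δ ^ 2 + δ - 1)

/-- κ(δ) = √(a(δ)+1) / (δ·(a(δ)+1+√(a(δ)+1))). -/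
noncomputable def kappaFn (δ : ℝ) : ℝ :=
  Real.sqrt (aFn δ + 1) / (δ * (aFn δ + 1 + Real.sqrt (aFn δ + 1)))

/-- `κ(δ) = 1 / (δ (√(a(δ)+1) + 1))` as soon as `a(δ) + 1 > 0`. -/
theorem kappaFn_eq {δ : ℝ} (ha : 0 < aFn δ + 1) :
    kappaFn δ = 1 / (Real.sqrt (aFn δ + 1) + 1) / δ := by
  have hs : 0 < Real.sqrt (aFn δ + 1) := Real.sqrt_pos.2 ha
  have hden : aFn δ + 1 + Real.sqrt (aFn δ + 1) =
      Real.sqrt (aFn δ + 1) * (Real.sqrt (aFn δ + 1) + 1) := by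
    linear_combination -Real.mul_self_sqrt ha.le
  rw [kappaFn, hden, mul_left_comm, div_mul_eq_div_div, div_self hs.ne', div_div, mul_comm δ]

theorem sqrt_two_sub_one_eq : Real.sqrt 2 - 1 = 1 / (Real.sqrt 2 + 1) := by
  rw [eq_div_iff (by positivity)]
  linear_combination Real.mul_self_sqrt (zero_le_two : (0 : ℝ) ≤ 2)

/-- For every real δ > 1 one has κ(δ) > (√2−1)/δ; moreover κ(1) = √2−1. -/
theorem stmt2 :
    (∀ δ : ℝ, 1 < δ → (Real.sqrt 2 - 1) / δ < kappaFn δ) ∧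
    kappaFn 1 = Real.sqrt 2 - 1 := by
  refine ⟨fun δ hδ => ?_, ?_⟩
  · have hδ0 : 0 < δ := by linarith
    have hd : 0 < δ ^ 2 + δ - 1 := by nlinarith
    have ha0 : 0 < aFn δ := div_pos (by positivity) hd
    have ha1 : aFn δ < 1 := (div_lt_one hd).2 (by linarith)
    have hs : Real.sqrt (aFn δ + 1) < Real.sqrt 2 :=
      Real.sqrt_lt_sqrt (by linarith) (by linarith)
    rw [kappaFn_eq (by linarith), sqrt_two_sub_one_eq]
    gcongr
  · have ha : aFn 1 + 1 = 2 := by norm_num [aFn]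
    rw [kappaFn_eq (by rw [ha]; norm_num), ha, sqrt_two_sub_one_eq, div_one]
end

section
/- Let H be a real Hilbert space, g : H → ℝ convex, F : H → H monotone, δ > 0, α ≥ 0. Let x : ℕ → H, y : ℕ → H and λ : ℕ → ℝ be sequences with λ(n) > 0 and λ(n) ≤ λ(n−1) for all n ≥ 1, y(n) = x(n) + δ(x(n) − x(n−1)) for all n ≥ 1, and for all n ≥ 1: ⟨x(n+1) − x(n) + λ(n)·F(y(n)), x − x(n+1)⟩ ≥ λ(n)(g(x(n+1)) − g(x)) for all x ∈ H, and λ(n)‖F(y(n)) − F(y(n−1))‖ ≤ α‖y(n) − y(n−1)‖. Let x̄ ∈ H satisfy Φ(x̄, y) ≥ 0 for all y ∈ H. For ε₁, ε₂ > 0 define a(n) = ‖x(n) − x̄‖² + 2λ(n−1)(1+δ)Φ(x̄, x(n−1)) + ((1+ε₂)/ε₁)·α·‖x(n) − y(n−1)‖² and b(n) = [ λ(n)/(δλ(n−1)) − (ε₁ + (1+ε₂)/ε₁)·α ]‖x(n+1) − y(n)‖² + [ λ(n)/(δλ(n−1)) − (α/ε₁)(1+1/ε₂) ]‖x(n) −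 y(n)‖² + (1 − λ(n)/(δλ(n−1)))‖x(n+1) − x(n)‖². Then a(n+1) ≤ a(n) − b(n) for all n ≥ 2. -/
open scoped RealInnerProductSpace

/-- Φ(x,y) := ⟨F(x), y−x⟩ + g(y) − g(x). -/
noncomputable def Phi {H : Type*} [NormedAddCommGroup H] [InnerProductSpace ℝ H]
    (F : H → H) (g : H → ℝ) (x y : H) : ℝ := ⟪F x, y - x⟫ + g y - g x

lemma two_mul_inner_sub_sub_eq {H : Type*} [NormedAddCommGroup H] [InnerProductSpace ℝ H]
    (u v w : H) : 2 * ⟪u - v, w - u⟫ = ‖w - v‖ ^ 2 - ‖u - v‖ ^ 2 - ‖w - u‖ ^ 2 := by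
  have h : w - v = (u - v) + (w - u) := by abel
  rw [h, norm_add_sq_real]
  ring

lemma norm_add_sq_le_weighted {H : Type*} [NormedAddCommGroup H] [InnerProductSpace ℝ H]
    (u v : H) {ε : ℝ} (hε : 0 < ε) :
    ‖u + v‖ ^ 2 ≤ (1 + ε) * ‖u‖ ^ 2 + (1 + 1 / ε) * ‖v‖ ^ 2 := by
  have h₁ : ‖u + v‖ ^ 2 ≤ (‖u‖ + ‖v‖) ^ 2 := by
    gcongr
    exact norm_add_le u v
  have h₂ : 0 ≤ (ε * ‖u‖ - ‖v‖) ^ 2 / ε := by positivity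
  have h₃ : (ε * ‖u‖ - ‖v‖) ^ 2 / ε = ε * ‖u‖ ^ 2 + 1 / ε * ‖v‖ ^ 2 - 2 * ‖u‖ * ‖v‖ := by
    field_simp
    ring
  linarith

lemma two_mul_le_weighted_sq (s t : ℝ) {ε : ℝ} (hε : 0 < ε) :
    2 * (s * t) ≤ s ^ 2 / ε + ε * t ^ 2 := by
  have h₂ : 0 ≤ (s - ε * t) ^ 2 / ε := by positivity
  have h₃ : (s - ε * t) ^ 2 / ε = s ^ 2 / ε + ε * t ^ 2 - 2 * (s * t) := by
    field_simp
    ring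
  linarith

/-- descent inequality a(n+1) ≤ a(n) − b(n) (Lemma 5, version (13) of the paper). -/
theorem stmt8 {H : Type*} [NormedAddCommGroup H] [InnerProductSpace ℝ H]
    (g : H → ℝ) (hg : ConvexOn ℝ Set.univ g) (F : H → H)
    (hmono : ∀ u v : H, 0 ≤ ⟪F u - F v, u - v⟫)
    (δ α : ℝ) (hδ : 0 < δ) (hα : 0 ≤ α)
    (x y : ℕ → H) (lam : ℕ → ℝ)
    (hlampos : ∀ n : ℕ, 1 ≤ n → 0 < lam n)
    (hlam0 : 0 < lam 0)
    (hlamdec : ∀ n : ℕ, 1 ≤ n → lam n ≤ lam (n - 1))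
    (hy : ∀ n : ℕ, 1 ≤ n → y n = x n + δ • (x n - x (n - 1)))
    (hstep : ∀ n : ℕ, 1 ≤ n → ∀ z : H,
      ⟪x (n + 1) - x n + lam n • F (y n), z - x (n + 1)⟫ ≥ lam n * (g (x (n + 1)) - g z))
    (hlin : ∀ n : ℕ, 1 ≤ n → lam n * ‖F (y n) - F (y (n - 1))‖ ≤ α * ‖y n - y (n - 1)‖)
    (xbar : H) (hxbar : ∀ z : H, 0 ≤ Phi F g xbar z)
    (ε₁ ε₂ : ℝ) (hε₁ : 0 < ε₁) (hε₂ : 0 < ε₂) :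
    let a : ℕ → ℝ := fun n =>
      ‖x n - xbar‖ ^ 2 + 2 * lam (n - 1) * (1 + δ) * Phi F g xbar (x (n - 1))
        + ((1 + ε₂) / ε₁) * α * ‖x n - y (n - 1)‖ ^ 2
    let b : ℕ → ℝ := fun n =>
      (lam n / (δ * lam (n - 1)) - (ε₁ + (1 + ε₂) / ε₁) * α) * ‖x (n + 1) - y n‖ ^ 2
        + (lam n / (δ * lam (n - 1)) - (α / ε₁) * (1 + 1 / ε₂)) * ‖x n - y n‖ ^ 2
        + (1 - lam n / (δ * lam (n - 1))) * ‖x (n + 1) - x n‖ ^ 2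
    ∀ n : ℕ, 2 ≤ n → a (n + 1) ≤ a n - b n := by
  intro a b n hn
  obtain ⟨m, rfl⟩ : ∃ m, n = m + 1 := ⟨n - 1, by omega⟩
  have hm : 1 ≤ m := by omega
  have hμ := hlampos m hm
  have hl := hlampos (m + 1) (by omega)
  have hdec := hlamdec (m + 1) (by omega)
  have hY := hy (m + 1) (by omega)
  have hlip := hlin (m + 1) (by omega)
  have hbar := hstep (m + 1) (by omega) xbar
  have hp := hstep m hm (x (m + 1 + 1))
  have hr := hstep m hm (x m)
  have hΦ := hxbar (x m)
  simp only [a, b, Nat.add_sub_cancel] at *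
  clear a b hstep hlin hxbar hlampos hlamdec hy
  generalize x (m + 1 + 1) = p at *
  generalize x (m + 1) = q at *
  generalize x m = r at *
  generalize y (m + 1) = Y at *
  generalize y m = W at *
  generalize lam (m + 1) = l at *
  generalize lam m = μ at *
  -- the step inequality at the previous iterate, tested at the extrapolated point
  have hprev : l / (δ * μ) * ⟪Y - q, p - Y⟫ + l * ⟪F W, p - Y⟫
      ≥ l * ((1 + δ) * g q - g p - δ * g r) := by
    have hsum : ⟪q - r + μ • F W, p - Y⟫ ≥ μ * ((1 + δ) * g q - g p - δ * g r) := by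
      have e : p - Y = (p - q) + δ • (r - q) := by rw [hY]; module
      rw [e, inner_add_right, inner_smul_right]
      nlinarith [mul_le_mul_of_nonneg_left hr hδ.le]
    have hYq : Y - q = δ • (q - r) := by rw [hY]; module
    rw [inner_add_left, real_inner_smul_left] at hsum
    rw [hYq, real_inner_smul_left]
    have hmul := mul_le_mul_of_nonneg_left hsum (div_pos hl hμ).le
    have e₁ : l / μ * (μ * ((1 + δ) * g q - g p - δ * g r))
        = l * ((1 + δ) * g q - g p - δ * g r) := by field_simp
    have e₂ : l / μ * (⟪q - r, p - Y⟫ + μ * ⟪F W, p - Y⟫)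
        = l / (δ * μ) * (δ * ⟪q - r, p - Y⟫) + l * ⟪F W, p - Y⟫ := by field_simp
    linarith
  have hcoer : l * ⟪F Y, xbar - Y⟫ ≤
      l * (-(1 + δ) * ⟪F xbar, q - xbar⟫ + δ * ⟪F xbar, r - xbar⟫) := by
    refine mul_le_mul_of_nonneg_left ?_ hl.le
    have h := hmono Y xbar
    have e : Y - xbar = (1 + δ) • (q - xbar) - δ • (r - xbar) := by rw [hY]; module
    have e' : xbar - Y = -(Y - xbar) := by abel
    rw [inner_sub_left] at h
    have e₂ : ⟪F xbar, Y - xbar⟫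
        = (1 + δ) * ⟪F xbar, q - xbar⟫ - δ * ⟪F xbar, r - xbar⟫ := by
      rw [e, inner_sub_right, inner_smul_right, inner_smul_right]
    rw [e', inner_neg_right]
    linarith
  have hsplit : l * ⟪F Y, xbar - p⟫ + l * ⟪F W, p - Y⟫
      = l * ⟪F Y - F W, Y - p⟫ + l * ⟪F Y, xbar - Y⟫ := by
    simp only [inner_sub_left, inner_sub_right]
    ring
  have hcs : 2 * (l * ⟪F Y - F W, Y - p⟫) ≤ α * (‖Y - W‖ ^ 2 / ε₁ + ε₁ * ‖p - Y‖ ^ 2) := by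
    have h₁ := mul_le_mul_of_nonneg_left (real_inner_le_norm (F Y - F W) (Y - p)) hl.le
    have h₂ := mul_le_mul_of_nonneg_right hlip (norm_nonneg (Y - p))
    have h₃ := mul_le_mul_of_nonneg_left (two_mul_le_weighted_sq ‖Y - W‖ ‖Y - p‖ hε₁) hα
    rw [norm_sub_rev p Y]
    linarith
  have hyoung : α * (‖Y - W‖ ^ 2 / ε₁) ≤ (1 + ε₂) / ε₁ * α * ‖q - W‖ ^ 2
      + α / ε₁ * (1 + 1 / ε₂) * ‖q - Y‖ ^ 2 := by
    have h := norm_add_sq_le_weighted (q - W) (Y - q) hε₂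
    have e : q - W + (Y - q) = Y - W := by abel
    rw [e, norm_sub_rev Y q] at h
    have h' := mul_le_mul_of_nonneg_left h (div_nonneg hα hε₁.le)
    have e₁ : α * (‖Y - W‖ ^ 2 / ε₁) = α / ε₁ * ‖Y - W‖ ^ 2 := by ring
    rw [e₁]
    refine h'.trans_eq ?_
    ring
  have hΦr : l * δ * Phi F g xbar r ≤ μ * (1 + δ) * Phi F g xbar r := by
    gcongr
    linarith
  have hi₁ := two_mul_inner_sub_sub_eq p q xbar
  have hi₂ := congrArg (l / (δ * μ) * ·) (two_mul_inner_sub_sub_eq Y q p)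
  rw [norm_sub_rev Y q] at hi₂
  rw [norm_sub_rev xbar q, norm_sub_rev xbar p] at hi₁
  rw [inner_add_left, real_inner_smul_left] at hbar
  simp only [Phi] at *
  generalize l / (δ * μ) = θ at *
  linarith
end
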